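/- Let X be uniform over a subset of {0,1}^n of size K, and let Ext : {0,1}^n × {0,1}^d → {0,1}^m be a uniformly random function. Then for every ε > 0, Pr_{Ext}[ E_{s∼U_d}[ KL(Ext(X,s) ‖ U_m) ] > ε ] ≤ 2^{MD − KDε/3}, where D = 2^d and M = 2^m. -/

import Mathlib

open scoped BigOperators

/-- KL divergence (in bits) from a distribution on `{0,1}^m` to uniform. -/
noncomputable def KLu (m : ℕ) (P : (Fin m → Bool) → ℝ) : ℝ :=
  ∑ x, P x * Real.logb 2 ((2 : ℝ) ^ m * P x)

/-- The number of times `f` takes the value `y`, as a real number. -/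
noncomputable def valueCount {α Y : Type*} [Fintype α] [DecidableEq Y] (f : α → Y) (y : Y) : ℝ :=
  ((Finset.univ.filter fun a => f a = y).card : ℝ)

/-- The size of the sample `f` times the KL divergence (in nats) from its empirical distribution
to uniform. -/
noncomputable def sampleKL {α Y : Type*} [Fintype α] [Fintype Y] [DecidableEq Y]
    (f : α → Y) : ℝ :=
  ∑ y, valueCount f y * Real.log (Fintype.card Y * valueCount f y / Fintype.card α)

lemma valueCount_nonneg {α Y : Type*} [Fintype α] [DecidableEq Y] (f : α → Y) (y : Y) :
    0 ≤ valueCount f y := Nat.cast_nonneg _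

lemma sum_valueCount {α Y : Type*} [Fintype α] [Fintype Y] [DecidableEq Y] (f : α → Y) :
    ∑ y, valueCount f y = Fintype.card α := by
  simp only [valueCount]
  rw [← Nat.cast_sum,
    ← Finset.card_eq_sum_card_fiberwise (fun _ _ => Finset.mem_coe.2 (Finset.mem_univ _)),
    Finset.card_univ]

lemma integral_exp_neg_mul_sq_add_mul {b : ℝ} (hb : 0 < b) (s : ℝ) :
    ∫ x : ℝ, Real.exp (-b * x ^ 2 + s * x) =
      Real.exp (s ^ 2 / (4 * b)) * Real.sqrt (Real.pi / b) := by
  have h : ∀ x : ℝ, Real.exp (-b * x ^ 2 + s * x) =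
      Real.exp (s ^ 2 / (4 * b)) * Real.exp (-b * (x - s / (2 * b)) ^ 2) := by
    intro x
    rw [← Real.exp_add]
    congr 1
    field_simp
    ring
  simp_rw [h]
  rw [MeasureTheory.integral_const_mul,
    MeasureTheory.integral_sub_right_eq_self (fun x : ℝ => Real.exp (-b * x ^ 2)),
    integral_gaussian]

lemma integrable_exp_neg_mul_sq_add_mul {b : ℝ} (hb : 0 < b) (s : ℝ) :
    MeasureTheory.Integrable fun x : ℝ => Real.exp (-b * x ^ 2 + s * x) := by
  by_contra h
  have h0 := MeasureTheory.integral_undef h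
  rw [integral_exp_neg_mul_sq_add_mul hb] at h0
  have : 0 < Real.exp (s ^ 2 / (4 * b)) * Real.sqrt (Real.pi / b) := by positivity
  exact this.ne' h0

/-- The signed sum of a Boolean sample. -/
noncomputable def signSum {α : Type*} [Fintype α] (g : α → Bool) : ℝ :=
  ∑ a, if g a then (1 : ℝ) else -1

lemma sum_exp_signSum_mul_le (α : Type*) [Fintype α] [DecidableEq α] (x : ℝ) :
    ∑ g : α → Bool, Real.exp (signSum g * x) ≤
      2 ^ Fintype.card α * Real.exp (Fintype.card α * (x ^ 2 / 2)) := by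
  have h : ∑ g : α → Bool, Real.exp (signSum g * x) =
      ∏ _a : α, ∑ b : Bool, Real.exp ((if b then (1 : ℝ) else -1) * x) := by
    rw [Finset.prod_univ_sum, Fintype.piFinset_univ]
    refine Finset.sum_congr rfl fun g _ => ?_
    rw [signSum, Finset.sum_mul, Real.exp_sum]
  have hc : ∑ b : Bool, Real.exp ((if b then (1 : ℝ) else -1) * x) = 2 * Real.cosh x := by
    rw [Fintype.sum_bool, Real.cosh_eq]
    simp
    ring
  rw [h, hc, Finset.prod_const, Finset.card_univ, mul_pow, Real.exp_nat_mul]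
  gcongr
  exact Real.cosh_le_exp_half_sq x

lemma sum_exp_signSum_sq_le (α : Type*) [Fintype α] [DecidableEq α] [Nonempty α] :
    ∑ g : α → Bool, Real.exp (signSum g ^ 2 / (3 * Fintype.card α)) ≤
      2 * 2 ^ Fintype.card α := by
  have hK : (0 : ℝ) < Fintype.card α := Nat.cast_pos.2 Fintype.card_pos
  set K : ℝ := (Fintype.card α : ℝ)
  have hb : 0 < 3 * K / 4 := by positivity
  have hpt : ∀ x : ℝ, ∑ g : α → Bool, Real.exp (-(3 * K / 4) * x ^ 2 + signSum g * x) ≤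
      2 ^ Fintype.card α * Real.exp (-(K / 4) * x ^ 2) := by
    intro x
    simp_rw [Real.exp_add, ← Finset.mul_sum]
    refine (mul_le_mul_of_nonneg_left (sum_exp_signSum_mul_le α x) (Real.exp_pos _).le).trans
      (le_of_eq ?_)
    rw [mul_left_comm, ← Real.exp_add]
    congr 2
    ring
  have hint : ∫ x : ℝ, ∑ g : α → Bool, Real.exp (-(3 * K / 4) * x ^ 2 + signSum g * x) ≤
      ∫ x : ℝ, 2 ^ Fintype.card α * Real.exp (-(K / 4) * x ^ 2) :=
    MeasureTheory.integral_mono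
      (MeasureTheory.integrable_finsetSum _ fun g _ => integrable_exp_neg_mul_sq_add_mul hb _)
      ((integrable_exp_neg_mul_sq (by positivity)).const_mul _) hpt
  rw [MeasureTheory.integral_finsetSum _ fun g _ => integrable_exp_neg_mul_sq_add_mul hb _,
    MeasureTheory.integral_const_mul, integral_gaussian] at hint
  simp_rw [integral_exp_neg_mul_sq_add_mul hb, ← Finset.sum_mul] at hint
  have hs : Real.sqrt (Real.pi / (K / 4)) ≤ 2 * Real.sqrt (Real.pi / (3 * K / 4)) := by
    rw [Real.sqrt_le_left (by positivity), mul_pow, Real.sq_sqrt (by positivity)]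
    rw [div_le_iff₀ (by positivity)]
    field_simp
    nlinarith [Real.pi_pos]
  have hpos : 0 < Real.sqrt (Real.pi / (3 * K / 4)) := by positivity
  have h4 : 4 * (3 * K / 4) = 3 * K := by ring
  rw [h4] at hint
  refine le_of_mul_le_mul_right (hint.trans ?_) hpos
  calc _ ≤ 2 ^ Fintype.card α * (2 * Real.sqrt (Real.pi / (3 * K / 4))) := by gcongr
    _ = _ := by ring

lemma sampleKL_bool_le {α : Type*} [Fintype α] [Nonempty α] (g : α → Bool) :
    sampleKL g ≤ signSum g ^ 2 / Fintype.card α := by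
  have hK : (0 : ℝ) < Fintype.card α := Nat.cast_pos.2 Fintype.card_pos
  have hsum := sum_valueCount g
  have hsign : signSum g = valueCount g true - valueCount g false := by
    simp [signSum, valueCount, Finset.sum_ite, sub_eq_add_neg]
  set K : ℝ := (Fintype.card α : ℝ)
  have hterm : ∀ b, valueCount g b * Real.log (Fintype.card Bool * valueCount g b / K) ≤
      valueCount g b * (2 * valueCount g b / K - 1) := by
    intro b
    rcases (valueCount_nonneg g b).eq_or_lt with h | h
    · simp [← h]
    · rw [Fintype.card_bool]
      exact mul_le_mul_of_nonneg_left (Real.log_le_sub_one_of_pos (by positivity)) h.le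
  refine (Finset.sum_le_sum fun b _ => hterm b).trans (le_of_eq ?_)
  rw [Fintype.sum_bool] at hsum ⊢
  rw [hsign, ← hsum]
  have : valueCount g true + valueCount g false ≠ 0 := hsum ▸ hK.ne'
  field_simp
  ring

lemma sum_exp_sampleKL_bool_le (α : Type*) [Fintype α] [DecidableEq α] :
    ∑ g : α → Bool, Real.exp (sampleKL g / 3) ≤ 2 * 2 ^ Fintype.card α := by
  cases isEmpty_or_nonempty α
  · simp [sampleKL, valueCount]
  · refine le_trans (Finset.sum_le_sum fun g _ => Real.exp_le_exp.2 ?_) (sum_exp_signSum_sq_le α)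
    rw [mul_comm, ← div_div]
    exact div_le_div_of_nonneg_right (sampleKL_bool_le g) (by norm_num)

/-- The chain rule for the KL divergence of the empirical distribution of a sample of pairs. -/
lemma sampleKL_prod {α Y Z : Type*} [Fintype α] [Fintype Y] [DecidableEq Y] [Fintype Z]
    [DecidableEq Z] (g : α → Z) (r : α → Y) :
    sampleKL (fun a => (g a, r a)) =
      sampleKL g + ∑ z, sampleKL (fun a : {a // g a = z} => r a) := by
  have hcount : ∀ z y, valueCount (fun a => (g a, r a)) (z, y) =
      valueCount (fun a : {a // g a = z} => r a) y := by
    intro z y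
    simp only [valueCount, Prod.mk.injEq]
    rw [← Fintype.card_subtype, ← Fintype.card_subtype,
      Fintype.card_congr (Equiv.subtypeSubtypeEquivSubtypeInter
        (fun a => g a = z) (fun a => r a = y))]
  have hcard : ∀ z, (Fintype.card {a // g a = z} : ℝ) = valueCount g z := by
    intro z
    rw [valueCount, Fintype.card_subtype]
  rw [sampleKL, Fintype.sum_prod_type, sampleKL, ← Finset.sum_add_distrib]
  refine Finset.sum_congr rfl fun z _ => ?_
  have hs := sum_valueCount (fun a : {a // g a = z} => r a)
  rw [hcard] at hs
  nth_rewrite 1 [← hs]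
  rw [sampleKL, Finset.sum_mul, ← Finset.sum_add_distrib]
  refine Finset.sum_congr rfl fun y _ => ?_
  rw [hcount, hcard]
  rcases (valueCount_nonneg (fun a : {a // g a = z} => r a) y).eq_or_lt with h | h
  · simp [← h]
  have hz : 0 < valueCount g z := h.trans_le
    (hs ▸ Finset.single_le_sum (fun y _ => valueCount_nonneg _ y) (Finset.mem_univ y))
  have hK : (0 : ℝ) < Fintype.card α := hz.trans_le
    (sum_valueCount g ▸ Finset.single_le_sum (fun z _ => valueCount_nonneg _ z) (Finset.mem_univ z))
  have hY : (0 : ℝ) < Fintype.card Y := Nat.cast_pos.2 (Fintype.card_pos_iff.2 ⟨y⟩)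
  have hZ : (0 : ℝ) < Fintype.card Z := Nat.cast_pos.2 (Fintype.card_pos_iff.2 ⟨z⟩)
  rw [← mul_add, ← Real.log_mul (by positivity) (by positivity), Fintype.card_prod]
  congr 2
  push_cast
  field_simp

/-- Splitting the index set of a sample along a predicate factorizes sums of products. -/
lemma sum_mul_restrict {α Y : Type*} [Fintype α] [DecidableEq α] [Fintype Y]
    (p : α → Prop) [DecidablePred p] [Fintype {a // p a}] [Fintype {a // ¬ p a}]
    (F : ({a // p a} → Y) → ℝ) (G : ({a // ¬ p a} → Y) → ℝ) :
    ∑ r : α → Y, F (fun a => r a) * G (fun a => r a) = (∑ r, F r) * ∑ r, G r := by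
  rw [Fintype.sum_mul_sum, ← Fintype.sum_prod_type']
  exact Fintype.sum_equiv (Equiv.piEquivPiSubtypeProd p fun _ => Y) _ _
          fun _ => rfl

/-- The exponential moment of order one third of `sampleKL` over uniform samples in `Y` is at most
`2 ^ (|Y| - 1)`, for every finite sample size. -/
def KLMomentBound (Y : Type) [Fintype Y] [DecidableEq Y] : Prop :=
  ∀ (α : Type) [Fintype α] [DecidableEq α], ∑ f : α → Y, Real.exp (sampleKL f / 3) ≤
    2 ^ Fintype.card Y / 2 * (Fintype.card Y : ℝ) ^ Fintype.card α

lemma sampleKL_equiv_comp {α Y Z : Type*} [Fintype α] [Fintype Y] [DecidableEq Y] [Fintype Z]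
    [DecidableEq Z] (e : Y ≃ Z) (f : α → Y) : sampleKL (e ∘ f) = sampleKL f := by
  refine (Fintype.sum_equiv e _ _ fun y => ?_).symm
  simp [valueCount, Fintype.card_congr e]

lemma KLMomentBound.congr {Y Z : Type} [Fintype Y] [DecidableEq Y] [Fintype Z] [DecidableEq Z]
    (e : Y ≃ Z) (h : KLMomentBound Y) : KLMomentBound Z := by
  intro α _ _
  rw [← Fintype.card_congr e]
  refine le_of_eq_of_le (Fintype.sum_equiv (Equiv.arrowCongr (Equiv.refl α) e) _ _ fun f => ?_).symm
    (h α)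
  rw [← sampleKL_equiv_comp e f]
  rfl

lemma KLMomentBound.of_unique (Y : Type) [Unique Y] [Fintype Y] [DecidableEq Y] :
    KLMomentBound Y := by
  intro α _ _
  have h : ∀ f : α → Y, sampleKL f = 0 := by
    intro f
    have hv : valueCount f default = Fintype.card α := by
      simp [valueCount, Subsingleton.elim _ (default : Y)]
    by_cases hα : (Fintype.card α : ℝ) = 0 <;> simp [sampleKL, hv, hα]
  simp [h]

lemma KLMomentBound.bool_prod {Y : Type} [Fintype Y] [DecidableEq Y] (h : KLMomentBound Y) :
    KLMomentBound (Bool × Y) := by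
  intro α _ _
  have hsplit : ∀ g : α → Bool,
      ∑ r : α → Y, Real.exp ((∑ z, sampleKL (fun a : {a // g a = z} => r a)) / 3) ≤
        (2 ^ Fintype.card Y / 2) ^ 2 * (Fintype.card Y : ℝ) ^ Fintype.card α := by
    intro g
    have hfac : ∑ r : α → Y, Real.exp ((∑ z, sampleKL (fun a : {a // g a = z} => r a)) / 3) =
        (∑ r : {a // g a = true} → Y, Real.exp (sampleKL r / 3)) *
          ∑ r : {a // ¬ g a = true} → Y, Real.exp (sampleKL r / 3) := by
      rw [← sum_mul_restrict (fun a => g a = true)]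
      refine Finset.sum_congr rfl fun r _ => ?_
      rw [Fintype.sum_bool, add_div, Real.exp_add]
      simp only [sampleKL, valueCount, ← Fintype.card_subtype, Bool.not_eq_true]
      congr! <;> simp
    rw [hfac]
    refine (mul_le_mul (h _) (h _) (by positivity) (by positivity)).trans (le_of_eq ?_)
    rw [mul_mul_mul_comm, ← pow_add, ← sq, Fintype.card_subtype_compl,
      Nat.add_sub_cancel' (Fintype.card_subtype_le _)]
  calc ∑ f : α → Bool × Y, Real.exp (sampleKL f / 3)
      = ∑ g : α → Bool, ∑ r : α → Y, Real.exp (sampleKL (fun a => (g a, r a)) / 3) := by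
        rw [← Fintype.sum_prod_type']
        exact Fintype.sum_equiv (Equiv.arrowProdEquivProdArrow α (fun _ => Bool) fun _ => Y) _ _
          fun _ => rfl
    _ = ∑ g : α → Bool, Real.exp (sampleKL g / 3) *
          ∑ r : α → Y, Real.exp ((∑ z, sampleKL (fun a : {a // g a = z} => r a)) / 3) := by
        simp_rw [sampleKL_prod, add_div, Real.exp_add, Finset.mul_sum]
    _ ≤ ∑ g : α → Bool, Real.exp (sampleKL g / 3) *
          ((2 ^ Fintype.card Y / 2) ^ 2 * (Fintype.card Y : ℝ) ^ Fintype.card α) := by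
        gcongr with g
        exact hsplit g
    _ ≤ 2 * 2 ^ Fintype.card α *
          ((2 ^ Fintype.card Y / 2) ^ 2 * (Fintype.card Y : ℝ) ^ Fintype.card α) := by
        rw [← Finset.sum_mul]
        gcongr
        exact sum_exp_sampleKL_bool_le α
    _ = _ := by
        rw [Fintype.card_prod, Fintype.card_bool]
        push_cast
        rw [mul_pow, pow_mul']
        ring

lemma klMomentBound_bitstrings : ∀ m : ℕ, KLMomentBound (Fin m → Bool)
  | 0 => KLMomentBound.of_unique _
  | m + 1 => (klMomentBound_bitstrings m).bool_prod.congr (Fin.consEquiv fun _ => Bool)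

lemma KLu_eq_sampleKL {X : Type*} {m : ℕ} (S : Finset X) (f : X → Fin m → Bool) :
    (S.card : ℝ) * Real.log 2 * KLu m
        (fun y => (S.card : ℝ)⁻¹ * ((S.filter fun x => f x = y).card : ℝ)) =
      sampleKL (fun x : {x // x ∈ S} => f x) := by
  have hv : ∀ y, valueCount (fun x : {x // x ∈ S} => f x) y =
      ((S.filter fun x => f x = y).card : ℝ) := by
    intro y
    rw [valueCount, Nat.cast_inj]
    refine Finset.card_bij (fun x _ => x.1) ?_ (fun _ _ _ _ => Subtype.ext) ?_ <;> simp +contextual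
  rcases S.eq_empty_or_nonempty with rfl | hS
  · simp [sampleKL, valueCount]
  have hK : (S.card : ℝ) ≠ 0 := Nat.cast_ne_zero.2 hS.card_pos.ne'
  have hlog : Real.log 2 ≠ 0 := (Real.log_pos one_lt_two).ne'
  rw [KLu, sampleKL, Finset.mul_sum]
  refine Finset.sum_congr rfl fun y _ => ?_
  rw [hv, Real.logb, Fintype.card_coe]
  simp only [Fintype.card_fun, Fintype.card_fin, Fintype.card_bool, Nat.cast_pow, Nat.cast_ofNat]
  rw [mul_left_comm (2 ^ m : ℝ), inv_mul_eq_div]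
  field_simp

lemma sum_exp_sampleKL_restrict_le {X : Type} [Fintype X] [DecidableEq X] (m : ℕ)
    (S : Finset X) :
    ∑ f : X → Fin m → Bool, Real.exp (sampleKL (fun x : {x // x ∈ S} => f x) / 3) ≤
      2 ^ 2 ^ m * (Fintype.card (X → Fin m → Bool) : ℝ) := by
  have h := sum_mul_restrict (Y := Fin m → Bool) (fun x => x ∈ S)
    (fun r => Real.exp (sampleKL r / 3)) (fun _ => 1)
  simp only [mul_one] at h
  have hm := klMomentBound_bitstrings m {x // x ∈ S}
  have hcard : (Fintype.card (X → Fin m → Bool) : ℝ) =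
      (Fintype.card (Fin m → Bool) : ℝ) ^ Fintype.card {x // x ∈ S} *
        (Fintype.card ({x // x ∉ S} → Fin m → Bool) : ℝ) := by
    rw [← Nat.cast_pow, ← Nat.cast_mul, ← Fintype.card_fun, ← Fintype.card_prod]
    exact congrArg _ (Fintype.card_congr (Equiv.piEquivPiSubtypeProd (fun x => x ∈ S) _))
  rw [h, Finset.sum_const, Finset.card_univ, nsmul_one, hcard, ← mul_assoc]
  refine mul_le_mul_of_nonneg_right (hm.trans ?_) (Nat.cast_nonneg _)
  have hc : Fintype.card (Fin m → Bool) = 2 ^ m := by simp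
  rw [hc]
  gcongr
  exact half_le_self (by positivity)

/-- A uniformly random function is, with high probability, a good strong
KL-extractor for a fixed flat source of size `K`: the fraction of functions
`Ext` for which the average (over seeds) KL divergence of `Ext(X, s)` to
uniform exceeds `ε` is at most `2^{MD - KDε/3}`. -/
theorem random_function_kl_bound (n d m K : ℕ) (hK : 0 < K)
    (S : Finset (Fin n → Bool)) (hS : S.card = K) (ε : ℝ) (hε : 0 < ε) :
    ((Finset.univ.filter
        (fun Ext : (Fin n → Bool) → (Fin d → Bool) → (Fin m → Bool) =>
          ε < ((2 : ℝ) ^ d)⁻¹ * ∑ s, KLu m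
            (fun y => (K : ℝ)⁻¹ *
              ((S.filter fun x => Ext x s = y).card : ℝ)))).card : ℝ)
      ≤ (2 : ℝ) ^ (((2 : ℝ) ^ m * (2 : ℝ) ^ d) - (K : ℝ) * (2 : ℝ) ^ d * ε / 3)
        * (Fintype.card ((Fin n → Bool) → (Fin d → Bool) → (Fin m → Bool)) : ℝ) := by
  subst hS
  have hD : (0 : ℝ) < 2 ^ d := by positivity
  have hlog : 0 < Real.log 2 := Real.log_pos one_lt_two
  have hKr : (0 : ℝ) < S.card := Nat.cast_pos.2 hK
  set w : ((Fin n → Bool) → (Fin m → Bool)) → ℝ :=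
    fun f => Real.exp (sampleKL (fun x : {x // x ∈ S} => f x) / 3) with hw
  have hmoment : ∑ Ext : (Fin n → Bool) → (Fin d → Bool) → (Fin m → Bool),
      ∏ s, w (fun x => Ext x s) ≤ (2 : ℝ) ^ ((2 : ℝ) ^ m * (2 : ℝ) ^ d) *
        (Fintype.card ((Fin n → Bool) → (Fin d → Bool) → (Fin m → Bool)) : ℝ) := by
    have hprod : ∑ Ext : (Fin n → Bool) → (Fin d → Bool) → (Fin m → Bool),
        ∏ s, w (fun x => Ext x s) = ∏ _s : Fin d → Bool, ∑ f, w f := by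
      rw [Finset.prod_univ_sum, Fintype.piFinset_univ]
      exact Fintype.sum_equiv (Equiv.piComm fun _ _ => Fin m → Bool) _ _ fun _ => rfl
    rw [hprod, Finset.prod_const, Finset.card_univ,
      Fintype.card_congr (Equiv.piComm fun (_ : Fin n → Bool) (_ : Fin d → Bool) => Fin m → Bool),
      Fintype.card_fun (α := Fin d → Bool)]
    refine (pow_le_pow_left₀ (Finset.sum_nonneg fun f _ => (Real.exp_pos _).le)
      (sum_exp_sampleKL_restrict_le m S) _).trans (le_of_eq ?_)
    have hc : Fintype.card (Fin d → Bool) = 2 ^ d := by simp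
    rw [mul_pow, Nat.cast_pow, ← pow_mul, hc, ← Real.rpow_natCast 2 (2 ^ m * 2 ^ d)]
    push_cast
    rfl
  have hmarkov : ((Finset.univ.filter
      (fun Ext : (Fin n → Bool) → (Fin d → Bool) → (Fin m → Bool) =>
        ε < ((2 : ℝ) ^ d)⁻¹ * ∑ s, KLu m
          (fun y => (S.card : ℝ)⁻¹ *
            ((S.filter fun x => Ext x s = y).card : ℝ)))).card : ℝ) *
      (2 : ℝ) ^ ((S.card : ℝ) * (2 : ℝ) ^ d * ε / 3) ≤
      ∑ Ext : (Fin n → Bool) → (Fin d → Bool) → (Fin m → Bool), ∏ s, w (fun x => Ext x s) := by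
    rw [← nsmul_eq_mul]
    refine (Finset.card_nsmul_le_sum _
      (fun Ext : (Fin n → Bool) → (Fin d → Bool) → (Fin m → Bool) => ∏ s, w (fun x => Ext x s))
      _ fun Ext hExt => ?_).trans
      (Finset.sum_le_sum_of_subset_of_nonneg (Finset.filter_subset _ _)
        fun _ _ _ => Finset.prod_nonneg fun _ _ => (Real.exp_pos _).le)
    have hlt := (Finset.mem_filter.1 hExt).2
    rw [inv_mul_eq_div, lt_div_iff₀ hD] at hlt
    simp only [hw]
    rw [← Real.exp_sum, Real.rpow_def_of_pos two_pos, Real.exp_le_exp, ← Finset.sum_div]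
    rw [Finset.sum_congr rfl fun s _ => (KLu_eq_sampleKL S fun x => Ext x s).symm]
    rw [← Finset.mul_sum]
    have := mul_le_mul_of_nonneg_left hlt.le (mul_pos hKr hlog).le
    linarith
  rw [Real.rpow_sub two_pos, div_mul_eq_mul_div, le_div_iff₀ (by positivity)]
  exact hmarkov.trans hmoment
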